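/- arXiv:2107.14189 — 4 statements merged into one kernel-verified Lean document; each statement's English description precedes it below -/
import Mathlib

section
/- Let k be a field, q ∈ k^* admitting a square root in k, and a ∈ k[h^{±1}] a nonzero element that is not a monomial. Then every unit of the generalized Weyl algebra k[h^{±1}](σ_inv, a) with σ_inv(h) = q h^{-1} is of the form α h^i for some α ∈ k^* and i ∈ ℤ. -/
open LaurentPolynomial

/-- The defining relations of the degree-one generalized Weyl algebra `k[h^{±1}](σ, a)`:
the generators `Sum.inl p` (for `p` a Laurent polynomial) give a copy of `k[h^{±1}]`,
and the generators `x = Sum.inr 0` and `y = Sum.inr 1` satisfy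
`y x = a`, `x y = σ a`, `x r = σ(r) x` and `y r = σ⁻¹(r) y` for all `r ∈ k[h^{±1}]`. -/
inductive GWARel (k : Type*) [CommRing k] (σ : LaurentPolynomial k ≃ₐ[k] LaurentPolynomial k)
    (a : LaurentPolynomial k) :
    FreeAlgebra k (LaurentPolynomial k ⊕ Fin 2) →
      FreeAlgebra k (LaurentPolynomial k ⊕ Fin 2) → Prop
  | add (r s : LaurentPolynomial k) :
      GWARel k σ a (FreeAlgebra.ι k (Sum.inl (r + s)))
        (FreeAlgebra.ι k (Sum.inl r) + FreeAlgebra.ι k (Sum.inl s))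
  | mul (r s : LaurentPolynomial k) :
      GWARel k σ a (FreeAlgebra.ι k (Sum.inl (r * s)))
        (FreeAlgebra.ι k (Sum.inl r) * FreeAlgebra.ι k (Sum.inl s))
  | smul (c : k) (r : LaurentPolynomial k) :
      GWARel k σ a (FreeAlgebra.ι k (Sum.inl (c • r))) (c • FreeAlgebra.ι k (Sum.inl r))
  | one : GWARel k σ a (FreeAlgebra.ι k (Sum.inl 1)) 1
  | xr (r : LaurentPolynomial k) :
      GWARel k σ a (FreeAlgebra.ι k (Sum.inr 0) * FreeAlgebra.ι k (Sum.inl r))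
        (FreeAlgebra.ι k (Sum.inl (σ r)) * FreeAlgebra.ι k (Sum.inr 0))
  | yr (r : LaurentPolynomial k) :
      GWARel k σ a (FreeAlgebra.ι k (Sum.inr 1) * FreeAlgebra.ι k (Sum.inl r))
        (FreeAlgebra.ι k (Sum.inl (σ.symm r)) * FreeAlgebra.ι k (Sum.inr 1))
  | yx : GWARel k σ a (FreeAlgebra.ι k (Sum.inr 1) * FreeAlgebra.ι k (Sum.inr 0))
        (FreeAlgebra.ι k (Sum.inl a))
  | xy : GWARel k σ a (FreeAlgebra.ι k (Sum.inr 0) * FreeAlgebra.ι k (Sum.inr 1))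
        (FreeAlgebra.ι k (Sum.inl (σ a)))

/-- The degree-one generalized Weyl algebra `k[h^{±1}](σ, a)`, presented as the quotient of
the free algebra on `k[h^{±1}] ⊕ {x, y}` by the generalized Weyl relations. -/
abbrev GWA (k : Type*) [CommRing k] (σ : LaurentPolynomial k ≃ₐ[k] LaurentPolynomial k)
    (a : LaurentPolynomial k) :=
  RingQuot (GWARel k σ a)

namespace GWA

variable {k : Type*} [CommRing k] (σ : LaurentPolynomial k ≃ₐ[k] LaurentPolynomial k)
  (a : LaurentPolynomial k)

/-- The copy of the Laurent polynomial `p` inside the generalized Weyl algebra. -/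
noncomputable def r (p : LaurentPolynomial k) : GWA k σ a :=
  RingQuot.mkAlgHom k (GWARel k σ a) (FreeAlgebra.ι k (Sum.inl p))

/-- The element `h` of the generalized Weyl algebra. -/
noncomputable def H : GWA k σ a := r σ a (T 1)

/-- The element `h⁻¹` of the generalized Weyl algebra. -/
noncomputable def Hinv : GWA k σ a := r σ a (T (-1))

/-- The generator `x` of the generalized Weyl algebra. -/
noncomputable def x : GWA k σ a :=
  RingQuot.mkAlgHom k (GWARel k σ a) (FreeAlgebra.ι k (Sum.inr 0))

/-- The generator `y` of the generalized Weyl algebra. -/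
noncomputable def y : GWA k σ a :=
  RingQuot.mkAlgHom k (GWARel k σ a) (FreeAlgebra.ι k (Sum.inr 1))

end GWA

/-- An element `a ∈ k[h^{±1}]` is a monomial if `a = c·hⁱ` for some `c ∈ k`, `i ∈ ℤ`. -/
def LaurentPolynomial.IsMonomial {k : Type*} [CommRing k] (a : LaurentPolynomial k) : Prop :=
  ∃ (c : k) (i : ℤ), a = C c * T i

/-- In a ring of twisted Laurent polynomials over a domain, invertible elements are homogeneous with
invertible coefficient. Elements are written `∑ pₙ Aₙ tⁿ` for fixed nonzero weights `Aₙ`. -/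
theorem exists_support_eq_singleton_of_twisted_mul_eq_one {k D : Type*} [CommRing k] [CommRing D]
    [IsDomain D] [Algebra k D] (τ : ℤ → D ≃ₐ[k] D) (A : ℤ → D) (hA : ∀ n, A n ≠ 0) (P Q : ℤ →₀ D)
    (h : ∀ m, (P.sum fun n p => p * A n * τ n (Q (m - n) * A (m - n))) = if m = 0 then 1 else 0) :
    ∃ N, P.support = {N} ∧ IsUnit (P N) ∧ IsUnit (A N) ∧ IsUnit (A (-N)) := by
  have hP : P.support.Nonempty := by
    rw [Finsupp.support_nonempty_iff]
    rintro rfl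
    simpa using h 0
  have hQ : Q.support.Nonempty := by
    rw [Finsupp.support_nonempty_iff]
    rintro rfl
    simpa using h 0
  have key : ∀ N ∈ P.support, ∀ M ∈ Q.support,
      (∀ n ∈ P.support, n ≠ N → N + M - n ∉ Q.support) →
      N + M = 0 ∧ P N * A N * τ N (Q M * A M) = 1 := by
    intro N hN M hM hne
    have hsum := h (N + M)
    rw [Finsupp.sum, Finset.sum_eq_single N] at hsum
    · rw [add_sub_cancel_left] at hsum
      have hne0 : P N * A N * τ N (Q M * A M) ≠ 0 := by
        refine mul_ne_zero (mul_ne_zero (by simpa using hN) (hA N)) ?_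
        rw [map_ne_zero_iff _ (τ N).injective]
        exact mul_ne_zero (by simpa using hM) (hA M)
      split_ifs at hsum with h0
      · exact ⟨h0, hsum⟩
      · exact absurd hsum hne0
    · intro n hn hnN
      have := hne n hn hnN
      rw [Finsupp.notMem_support_iff] at this
      simp [this]
    · exact fun h' => absurd hN h'
  obtain ⟨htop, hone⟩ :=
      key _ (P.support.max'_mem hP) _ (Q.support.max'_mem hQ) fun n hn hne hmem => by
    have h1 := P.support.le_max' n hn
    have h2 := Q.support.le_max' _ hmem
    omega
  obtain ⟨hbot, -⟩ :=
      key _ (P.support.min'_mem hP) _ (Q.support.min'_mem hQ) fun n hn hne hmem => by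
    have h1 := P.support.min'_le n hn
    have h2 := Q.support.min'_le _ hmem
    omega
  have hQle := Q.support.min'_le _ (Q.support.max'_mem hQ)
  set N := P.support.max' hP
  refine ⟨N, ?_, ?_⟩
  · refine Finset.eq_singleton_iff_unique_mem.2 ⟨P.support.max'_mem hP, fun n hn => ?_⟩
    have h1 := P.support.min'_le n hn
    have h2 := P.support.le_max' n hn
    omega
  · have hM : Q.support.max' hQ = -N := by omega
    rw [hM] at hone
    have hu := IsUnit.of_mul_eq_one _ hone
    have hv := IsUnit.of_mul_eq_one_right _ hone
    rw [MulEquiv.isUnit_map] at hv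
    exact ⟨isUnit_of_mul_isUnit_left hu, isUnit_of_mul_isUnit_right hu,
      isUnit_of_mul_isUnit_right hv⟩

/-- Units of the Laurent polynomial ring over a domain are monomials. -/
theorem LaurentPolynomial.exists_eq_C_mul_T_of_isUnit {k : Type*} [CommRing k] [IsDomain k]
    {p : LaurentPolynomial k} (hp : IsUnit p) : ∃ (α : k) (i : ℤ), α ≠ 0 ∧ p = C α * T i := by
  obtain ⟨w, hw⟩ := hp.exists_right_inv
  obtain ⟨N, hN, hu, -⟩ := exists_support_eq_singleton_of_twisted_mul_eq_one
    (fun _ => (AlgEquiv.refl : k ≃ₐ[k] k)) (fun _ => 1) (fun _ => one_ne_zero) p.coeff w.coeff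
    (fun m => by
      have := congrArg (fun f => f.coeff m) hw
      simp only [AddMonoidAlgebra.coeff_mul] at this
      rw [← T_zero, T_apply] at this
      simp only [mul_one, AlgEquiv.coe_refl, id, eq_comm (a := m), ← this]
      refine Finsupp.sum_congr fun n _ => ?_
      rw [Finsupp.sum, Finset.sum_eq_single (m - n)]
      · simp
      · intro l _ hl
        exact if_neg (by omega)
      · intro hm
        simp [Finsupp.notMem_support_iff.1 hm])
  refine ⟨p.coeff N, N, hu.ne_zero, ?_⟩
  ext n
  rw [← single_eq_C_mul_T, AddMonoidAlgebra.coeff_single, Finsupp.single_apply]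
  split_ifs with h
  · rw [h]
  · exact Finsupp.notMem_support_iff.1 (by rw [hN]; simpa using Ne.symm h)

namespace GWA

section Relations

variable {k : Type*} [CommRing k] (σ : LaurentPolynomial k ≃ₐ[k] LaurentPolynomial k)
  (a : LaurentPolynomial k)

theorem r_add (p p' : LaurentPolynomial k) : r σ a (p + p') = r σ a p + r σ a p' := by
  simpa [r] using RingQuot.mkAlgHom_rel k (GWARel.add (σ := σ) (a := a) p p')

theorem r_mul (p p' : LaurentPolynomial k) : r σ a (p * p') = r σ a p * r σ a p' := by
  simpa [r] using RingQuot.mkAlgHom_rel k (GWARel.mul (σ := σ) (a := a) p p')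

theorem r_smul (c : k) (p : LaurentPolynomial k) : r σ a (c • p) = c • r σ a p := by
  simpa [r] using RingQuot.mkAlgHom_rel k (GWARel.smul (σ := σ) (a := a) c p)

theorem r_one : r σ a 1 = 1 := by
  simpa [r] using RingQuot.mkAlgHom_rel k (GWARel.one (σ := σ) (a := a))

theorem x_mul_r (p : LaurentPolynomial k) : x σ a * r σ a p = r σ a (σ p) * x σ a := by
  simpa [r, x] using RingQuot.mkAlgHom_rel k (GWARel.xr (σ := σ) (a := a) p)

theorem y_mul_r (p : LaurentPolynomial k) : y σ a * r σ a p = r σ a (σ.symm p) * y σ a := by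
  simpa [r, y] using RingQuot.mkAlgHom_rel k (GWARel.yr (σ := σ) (a := a) p)

theorem y_mul_x : y σ a * x σ a = r σ a a := by
  simpa [r, x, y] using RingQuot.mkAlgHom_rel k (GWARel.yx (σ := σ) (a := a))

theorem x_mul_y : x σ a * y σ a = r σ a (σ a) := by
  simpa [r, x, y] using RingQuot.mkAlgHom_rel k (GWARel.xy (σ := σ) (a := a))

/-- The basis vector of degree `n`: a power of `x` if `n ≥ 0`, a power of `y` if `n < 0`. -/
noncomputable def gen : ℤ → GWA k σ a
  | .ofNat n => x σ a ^ n
  | .negSucc n => y σ a ^ (n + 1)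

theorem exists_x_mul_gen (n : ℤ) : ∃ p, x σ a * gen σ a n = r σ a p * gen σ a (n + 1) := by
  rcases n with n | _ | n
  · exact ⟨1, by rw [r_one, one_mul]; exact (pow_succ' _ _).symm⟩
  · exact ⟨σ a, by simpa [gen] using x_mul_y σ a⟩
  · refine ⟨σ a, ?_⟩
    have : Int.negSucc (n + 1) + 1 = Int.negSucc n := by omega
    rw [this, gen, gen, pow_succ' _ (n + 1), ← mul_assoc, x_mul_y]

theorem exists_y_mul_gen (n : ℤ) : ∃ p, y σ a * gen σ a n = r σ a p * gen σ a (n - 1) := by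
  rcases n with (_ | n) | n
  · refine ⟨1, ?_⟩
    have : Int.ofNat 0 - 1 = Int.negSucc 0 := rfl
    rw [this, gen, gen, r_one, one_mul, pow_zero, mul_one, zero_add, pow_one]
  · refine ⟨a, ?_⟩
    have : Int.ofNat (n + 1) - 1 = Int.ofNat n := by simp
    rw [this, gen, gen, pow_succ', ← mul_assoc, y_mul_x]
  · refine ⟨1, ?_⟩
    have : Int.negSucc n - 1 = Int.negSucc (n + 1) := by omega
    rw [this, gen, gen, pow_succ' _ (n + 1), r_one, one_mul]

/-- Every element of the generalized Weyl algebra is a left `k[h^{±1}]`-combination of the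
elements `gen n`. -/
theorem exists_eq_sum_gen (b : GWA k σ a) :
    ∃ P : ℤ →₀ LaurentPolynomial k, b = P.sum fun n p => r σ a p * gen σ a n := by
  let f : (ℤ →₀ LaurentPolynomial k) →+ GWA k σ a :=
    Finsupp.liftAddHom fun n => AddMonoidHom.mk' (fun p => r σ a p * gen σ a n)
      fun p p' => by rw [r_add, add_mul]
  have hf (n p) : f (Finsupp.single n p) = r σ a p * gen σ a n :=
    Finsupp.liftAddHom_apply_single _ n p
  have hmul (c : GWA k σ a) (hc : ∀ n p, c * (r σ a p * gen σ a n) ∈ f.range) :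
      ∀ w ∈ f.range, c * w ∈ f.range := by
    rintro _ ⟨P, rfl⟩
    induction P using Finsupp.induction_linear with
    | zero => simp
    | add P Q hP hQ => rw [map_add, mul_add]; exact add_mem hP hQ
    | single n p => rw [hf]; exact hc n p
  have hr (p : LaurentPolynomial k) : ∀ w ∈ f.range, r σ a p * w ∈ f.range :=
    hmul _ fun n p' => ⟨.single n (p * p'), by rw [hf, r_mul, mul_assoc]⟩
  have hall (c : FreeAlgebra k (LaurentPolynomial k ⊕ Fin 2)) :
      ∀ w ∈ f.range, RingQuot.mkAlgHom k (GWARel k σ a) c * w ∈ f.range := by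
    induction c using FreeAlgebra.induction with
    | grade0 c =>
      intro w hw
      have := hr (c • 1) w hw
      rwa [r_smul, r_one, ← Algebra.algebraMap_eq_smul_one, ← AlgHom.commutes
        (RingQuot.mkAlgHom k (GWARel k σ a))] at this
    | grade1 g =>
      rcases g with p | i
      · exact hr p
      · refine hmul _ fun n p => ?_
        fin_cases i
        · obtain ⟨p', hp'⟩ := exists_x_mul_gen σ a n
          refine ⟨.single (n + 1) (σ p * p'), ?_⟩
          change _ = x σ a * _
          rw [hf, ← mul_assoc, x_mul_r, mul_assoc, hp', ← mul_assoc, r_mul]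
        · obtain ⟨p', hp'⟩ := exists_y_mul_gen σ a n
          refine ⟨.single (n - 1) (σ.symm p * p'), ?_⟩
          change _ = y σ a * _
          rw [hf, ← mul_assoc, y_mul_r, mul_assoc, hp', ← mul_assoc, r_mul]
    | mul c d hc hd => intro w hw; rw [map_mul, mul_assoc]; exact hc _ (hd w hw)
    | add c d hc hd => intro w hw; rw [map_add, add_mul]; exact add_mem (hc w hw) (hd w hw)
  obtain ⟨c, rfl⟩ := RingQuot.mkAlgHom_surjective k (GWARel k σ a) b
  obtain ⟨P, hP⟩ := hall c 1 ⟨.single 0 1, by rw [hf, r_one, one_mul]; exact pow_zero _⟩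
  rw [mul_one] at hP
  refine ⟨P, hP.symm.trans ?_⟩
  simp [f, Finsupp.liftAddHom_apply]

/-- The images of the generators under the regular representation of the skew Laurent
polynomial ring `k[h^{±1}][t^{±1}; σ]` with `x ↦ t`, `y ↦ a t⁻¹`. -/
noncomputable def repGen :
    LaurentPolynomial k ⊕ Fin 2 → Module.End k (ℤ → LaurentPolynomial k)
  | .inl p => LinearMap.mulLeft k (fun _ => p)
  | .inr 0 =>
    { toFun := fun f m => σ (f (m - 1))
      map_add' := fun f g => by ext1; simp
      map_smul' := fun c f => by ext1; simp }
  | .inr 1 =>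
    { toFun := fun f m => a * σ.symm (f (m + 1))
      map_add' := fun f g => by ext1; simp [mul_add]
      map_smul' := fun c f => by ext1; simp }

/-- The representation of the generalized Weyl algebra on the skew Laurent polynomial ring. -/
noncomputable def rep : GWA k σ a →ₐ[k] Module.End k (ℤ → LaurentPolynomial k) :=
  RingQuot.liftAlgHom k ⟨FreeAlgebra.lift k (repGen σ a), fun _ _ h => by
    induction h <;> refine LinearMap.ext fun f => funext fun m => ?_ <;>
      simp [repGen, add_mul, mul_assoc, mul_left_comm]⟩

theorem rep_r (p : LaurentPolynomial k) (f : ℤ → LaurentPolynomial k) (m : ℤ) :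
    rep σ a (r σ a p) f m = p * f m := by
  simp [rep, r, repGen]

theorem rep_x (f : ℤ → LaurentPolynomial k) (m : ℤ) :
    rep σ a (x σ a) f m = σ (f (m - 1)) := by
  simp [rep, x, repGen]

theorem rep_y (f : ℤ → LaurentPolynomial k) (m : ℤ) :
    rep σ a (y σ a) f m = a * σ.symm (f (m + 1)) := by
  simp [rep, y, repGen]

theorem rep_x_pow (n : ℕ) (f : ℤ → LaurentPolynomial k) (m : ℤ) :
    rep σ a (x σ a ^ n) f m = (σ ^ (n : ℤ)) (f (m - n)) := by
  induction n generalizing m with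
  | zero => simp
  | succ n ih =>
    rw [pow_succ', map_mul, Module.End.mul_apply, rep_x, ih, Nat.cast_succ, add_comm (n : ℤ) 1,
      zpow_one_add, AlgEquiv.mul_apply, sub_sub]

variable [IsDomain k]

theorem exists_rep_y_pow (ha : a ≠ 0) (n : ℕ) : ∃ c : LaurentPolynomial k, c ≠ 0 ∧ a ∣ c ∧
    ∀ (f : ℤ → LaurentPolynomial k) (m : ℤ),
      rep σ a (y σ a ^ (n + 1)) f m = c * (σ ^ Int.negSucc n) (f (m - Int.negSucc n)) := by
  induction n with
  | zero => exact ⟨a, ha, dvd_rfl, fun f m => by rw [zero_add, pow_one, rep_y]; rfl⟩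
  | succ n ih =>
    obtain ⟨c, hc, -, h⟩ := ih
    refine ⟨a * σ.symm c, mul_ne_zero ha (by simpa using hc), dvd_mul_right _ _, fun f m => ?_⟩
    have h1 : Int.negSucc (n + 1) = -1 + Int.negSucc n := by omega
    rw [pow_succ', map_mul, Module.End.mul_apply, rep_y, h, h1, zpow_add, AlgEquiv.mul_apply,
      map_mul, mul_assoc, zpow_neg_one, sub_add_eq_sub_sub, sub_neg_eq_add]
    rfl

theorem exists_rep_gen (ha : a ≠ 0) (n : ℤ) : ∃ c : LaurentPolynomial k, c ≠ 0 ∧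
    (n < 0 → a ∣ c) ∧ ∀ (f : ℤ → LaurentPolynomial k) (m : ℤ),
      rep σ a (gen σ a n) f m = c * (σ ^ n) (f (m - n)) := by
  rcases n with n | n
  · exact ⟨1, one_ne_zero, fun h => by simp at h; omega,
      fun f m => by rw [one_mul]; exact rep_x_pow σ a n f m⟩
  · obtain ⟨c, hc, hd, h⟩ := exists_rep_y_pow σ a ha n
    exact ⟨c, hc, fun _ => hd, h⟩

/-- If `a` is neither zero nor a unit, the units of the generalized Weyl algebra are the units of
the Laurent polynomial ring. -/
theorem exists_eq_r_of_isUnit (ha : a ≠ 0) (ha' : ¬ IsUnit a) {u : GWA k σ a} (hu : IsUnit u) :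
    ∃ p, IsUnit p ∧ u = r σ a p := by
  choose A hA hdvd hrep using exists_rep_gen σ a ha
  obtain ⟨v, huv⟩ := hu.exists_right_inv
  obtain ⟨P, rfl⟩ := exists_eq_sum_gen σ a u
  obtain ⟨Q, rfl⟩ := exists_eq_sum_gen σ a v
  have hsum (P : ℤ →₀ LaurentPolynomial k) (f : ℤ → LaurentPolynomial k) (m : ℤ) :
      rep σ a (P.sum fun n p => r σ a p * gen σ a n) f m =
        P.sum fun n p => p * A n * (σ ^ n) (f (m - n)) := by
    simp only [Finsupp.sum, map_sum, LinearMap.sum_apply, Finset.sum_apply, map_mul,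
      Module.End.mul_apply, rep_r, hrep, mul_assoc]
  have hQ (m : ℤ) : rep σ a (Q.sum fun n p => r σ a p * gen σ a n) (Pi.single 0 1) m =
      Q m * A m := by
    rw [hsum, Finsupp.sum, Finset.sum_eq_single m]
    · simp
    · intro n _ hn
      rw [Pi.single_eq_of_ne (sub_ne_zero.2 hn.symm), map_zero, mul_zero]
    · intro hm
      rw [Finsupp.notMem_support_iff.1 hm, zero_mul, zero_mul]
  obtain ⟨N, hN, hPN, hAN, hAN'⟩ := exists_support_eq_singleton_of_twisted_mul_eq_one
    (fun n => σ ^ n) A hA P Q fun m => by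
      simp only [← hQ]
      rw [← hsum, ← Module.End.mul_apply, ← map_mul, huv, map_one, Module.End.one_apply,
        Pi.single_apply]
  have hN0 : N = 0 := by
    by_contra hne
    rcases lt_or_gt_of_ne hne with h | h
    · exact ha' (isUnit_of_dvd_unit (hdvd N h) hAN)
    · exact ha' (isUnit_of_dvd_unit (hdvd (-N) (by omega)) hAN')
  subst hN0
  refine ⟨P 0, hPN, ?_⟩
  rw [Finsupp.sum, hN, Finset.sum_singleton]
  exact (congrArg _ (pow_zero _)).trans (mul_one _)

end Relations

end GWA

/-- For `q ∈ k^*` with a square root in `k` and `a ≠ 0` not a monomial,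
every unit of `k[h^{±1}](σ_inv, a)` with `σ_inv(h) = q h⁻¹` is of the form `α hⁱ` with
`α ∈ k^*`, `i ∈ ℤ`. -/
theorem units_involution_gwa (k : Type*) [Field k] (q : k) (hq0 : q ≠ 0)
    (s : k) (hs : s ^ 2 = q)
    (σ : LaurentPolynomial k ≃ₐ[k] LaurentPolynomial k) (hσ : σ (T 1) = C q * T (-1))
    (a : LaurentPolynomial k) (ha0 : a ≠ 0) (ha : ¬ a.IsMonomial)
    (u : (GWA k σ a)ˣ) :
    ∃ (α : k) (i : ℤ), α ≠ 0 ∧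
      (u : GWA k σ a) = algebraMap k (GWA k σ a) α * GWA.r σ a (T i) := by
  have ha' : ¬ IsUnit a := fun h => by
    obtain ⟨α, i, -, h⟩ := exists_eq_C_mul_T_of_isUnit h
    exact ha ⟨α, i, h⟩
  obtain ⟨p, hp, hu⟩ := GWA.exists_eq_r_of_isUnit σ a ha0 ha' u.isUnit
  obtain ⟨α, i, hα, rfl⟩ := exists_eq_C_mul_T_of_isUnit hp
  exact ⟨α, i, hα, by rw [hu, ← smul_eq_C_mul, GWA.r_smul, Algebra.smul_def]⟩
end

section
/- Let k be a field of characteristic not 2, and let p, g ∈ k[h^{±1}] be Laurent polynomials such that p(h) + p(h^{-1}) = g(h)·(h^{-1} − h), where p(h^{-1}) denotes the image of p under the k-algebra automorphism of k[h^{±1}] sending h to h^{-1}. Then there exists m ∈ k[h^{±1}] such that p(h) = m(h)·(h^{-1} − h). -/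
open LaurentPolynomial

/-- `h⁻¹ − h` divides `h⁻ⁿ − hⁿ` for every integer `n`. -/
theorem LaurentPolynomial.T_neg_one_sub_T_one_dvd {R : Type*} [CommRing R] (n : ℤ) :
    (T (-1) - T 1 : LaurentPolynomial R) ∣ T (-n) - T n := by
  have hnat (n : ℕ) : (T (-1) - T 1 : LaurentPolynomial R) ∣ T (-(n : ℤ)) - T n := by
    simpa [T_pow] using sub_dvd_pow_sub_pow (T (-1) : LaurentPolynomial R) (T 1) n
  obtain ⟨n, rfl | rfl⟩ := n.eq_nat_or_neg
  · exact hnat n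
  · rw [neg_neg, dvd_sub_comm]
    exact hnat n

/-- Modulo `h⁻¹ − h`, the automorphism `h ↦ h⁻¹` is the identity. -/
theorem LaurentPolynomial.T_neg_one_sub_T_one_dvd_invert_sub {R : Type*} [CommRing R]
    (p : LaurentPolynomial R) :
    (T (-1) - T 1 : LaurentPolynomial R) ∣ invert p - p := by
  induction p using LaurentPolynomial.induction_on' with
  | add p q hp hq =>
    rw [map_add, add_sub_add_comm]
    exact dvd_add hp hq
  | C_mul_T n a =>
    rw [map_mul, invert_C, invert_T, ← mul_sub]
    exact (T_neg_one_sub_T_one_dvd n).mul_left _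

/-- Over a field of characteristic not `2`, if
`p(h) + p(h⁻¹) = g(h)·(h⁻¹ − h)`, then `p(h) = m(h)·(h⁻¹ − h)` for some Laurent
polynomial `m`.  Here `p(h⁻¹)` is the image of `p` under the automorphism `h ↦ h⁻¹`
(`LaurentPolynomial.invert`). -/
theorem laurent_sym_factor (k : Type*) [Field k] (hchar : (2 : k) ≠ 0)
    (p g : LaurentPolynomial k)
    (h : p + LaurentPolynomial.invert p = g * (T (-1) - T 1)) :
    ∃ m : LaurentPolynomial k, p = m * (T (-1) - T 1) := by
  obtain ⟨q, hq⟩ := T_neg_one_sub_T_one_dvd_invert_sub p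
  have htwo : (C 2⁻¹ : LaurentPolynomial k) * 2 = 1 := by
    rw [← map_ofNat C 2, ← map_mul, inv_mul_cancel₀ hchar, map_one]
  refine ⟨C 2⁻¹ * (g - q), ?_⟩
  linear_combination C 2⁻¹ * h - C 2⁻¹ * hq - p * htwo
end

section
/- Let k be a field of characteristic not 2 and p ∈ k[h^{±1}]. Then p(h) = −h^2·p(h^{-1}) (where p(h^{-1}) denotes the image of p under the k-algebra automorphism of k[h^{±1}] sending h to h^{-1}) if and only if there exists g ∈ k[h^{±1}] with g(h) = g(h^{-1}) such that p(h) = (h^2 − 1)·g(h). -/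
open LaurentPolynomial

namespace LaurentPolynomial

lemma T_one_sub_T_neg_one_ne_zero {R : Type*} [Ring R] [Nontrivial R] :
    (T 1 - T (-1) : LaurentPolynomial R) ≠ 0 := by
  intro h
  simpa using congrArg (fun f : LaurentPolynomial R ↦ f.coeff 1) h

lemma T_one_sub_T_neg_one_dvd_T_sub_T_neg {R : Type*} [CommRing R] (n : ℤ) :
    (T 1 - T (-1) : LaurentPolynomial R) ∣ T n - T (-n) := by
  have key (m : ℕ) : (T 1 - T (-1) : LaurentPolynomial R) ∣ T m - T (-m) := by
    simpa [T_pow] using sub_dvd_pow_sub_pow (T 1 : LaurentPolynomial R) (T (-1)) m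
  obtain ⟨m, rfl | rfl⟩ := n.eq_nat_or_neg
  · exact key m
  · rw [neg_neg]
    exact (dvd_sub_comm).mp (key m)

lemma T_one_sub_T_neg_one_dvd_sub_invert {R : Type*} [CommRing R] (q : LaurentPolynomial R) :
    T 1 - T (-1) ∣ q - invert q := by
  induction q using LaurentPolynomial.induction_on' with
  | add p q hp hq =>
    rw [map_add, add_sub_add_comm]
    exact dvd_add hp hq
  | C_mul_T n a =>
    rw [map_mul, invert_C, invert_T, ← mul_sub]
    exact (T_one_sub_T_neg_one_dvd_T_sub_T_neg n).mul_left _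

/-- If `2` is a nonzero scalar, a Laurent polynomial that is antisymmetric under `h ↦ h⁻¹` is
`h - h⁻¹` times a symmetric one. -/
lemma exists_eq_mul_of_invert_eq_neg {k : Type*} [Field k] (hchar : (2 : k) ≠ 0)
    {q : LaurentPolynomial k} (hq : invert q = -q) :
    ∃ g : LaurentPolynomial k, invert g = g ∧ q = (T 1 - T (-1)) * g := by
  obtain ⟨r, hr⟩ := T_one_sub_T_neg_one_dvd_sub_invert q
  have hhalf : (C (2⁻¹ : k)) * 2 = 1 := by
    rw [← map_ofNat C 2, ← map_mul, inv_mul_cancel₀ hchar, map_one]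
  have hqg : q = (T 1 - T (-1)) * (C 2⁻¹ * r) := by
    linear_combination C 2⁻¹ * hr + C 2⁻¹ * hq - q * hhalf
  refine ⟨C 2⁻¹ * r, ?_, hqg⟩
  have hinv := congrArg invert hqg
  generalize C 2⁻¹ * r = g at hqg hinv ⊢
  rw [hq, map_mul, map_sub, invert_T, invert_T, neg_neg] at hinv
  apply mul_left_cancel₀ (T_one_sub_T_neg_one_ne_zero (R := k))
  linear_combination hinv + hqg

end LaurentPolynomial

/-- Over a field of characteristic not `2`, a Laurent polynomial satisfies
`p(h) = −h²·p(h⁻¹)` if and only if `p(h) = (h² − 1)·g(h)` for some `g` with `g(h) = g(h⁻¹)`.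
Here `p(h⁻¹)` is the image of `p` under the automorphism `h ↦ h⁻¹`
(`LaurentPolynomial.invert`). -/
theorem laurent_antisym_iff (k : Type*) [Field k] (hchar : (2 : k) ≠ 0)
    (p : LaurentPolynomial k) :
    p = -(T 2 * LaurentPolynomial.invert p) ↔
      ∃ g : LaurentPolynomial k, LaurentPolynomial.invert g = g ∧ p = (T 2 - 1) * g := by
  have h₁ : (T 1 * T (-1) : LaurentPolynomial k) = 1 := by rw [← T_add]; simp
  have h₂ : (T 2 : LaurentPolynomial k) = T 1 * T 1 := by rw [← T_add]; rfl
  constructor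
  · intro hp
    have hq : invert (T (-1) * p) = -(T (-1) * p) := by
      rw [map_mul, invert_T, neg_neg]
      linear_combination T (-1) * hp - T (-1) * invert p * h₂ - T 1 * invert p * h₁
    obtain ⟨g, hg, hpg⟩ := exists_eq_mul_of_invert_eq_neg hchar hq
    refine ⟨g, hg, ?_⟩
    linear_combination T 1 * hpg - p * h₁ - g * h₁ - g * h₂
  · rintro ⟨g, hg, rfl⟩
    have h₃ : (T 2 * T (-2) : LaurentPolynomial k) = 1 := by rw [← T_add]; simp
    rw [map_mul, hg, map_sub, invert_T, map_one]
    linear_combination g * h₃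
end

section
/- Let k be a field of characteristic not 2, and A = k[h^{±1}](σ_inv, 1) with σ_inv(h) = h^{-1}. Then every k-linear derivation D of A can be written as D = ad_t + D_{z_1,z_2}, where t ∈ A, z_1, z_2 ∈ Z(A), and D_{z_1,z_2} is the derivation of A determined by D_{z_1,z_2}(h) = (h^2 − 1)z_1, D_{z_1,z_2}(x) = z_2 x, D_{z_1,z_2}(y) = −z_2 y. Moreover, in such a decomposition the central elements z_1, z_2 and the inner derivation ad_t are uniquely determined by D. -/
open LaurentPolynomial

/-- A `k`-linear derivation of a (possibly noncommutative) `k`-algebra. -/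
def IsDeriv {k A : Type*} [CommSemiring k] [Semiring A] [Algebra k A]
    (D : A →ₗ[k] A) : Prop :=
  ∀ u v : A, D (u * v) = D u * v + u * D v

/-- The inner derivation `ad_t : u ↦ t u − u t`. -/
noncomputable def adDer {k A : Type*} [CommSemiring k] [Ring A] [Algebra k A] (t : A) :
    A →ₗ[k] A :=
  LinearMap.mulLeft k t - LinearMap.mulRight k t

theorem twisted_mul_eq {R A : Type*} [CommRing R] [Ring A] {φ : R →+* A} {τ : R →+* R} {w : R}
    {x : A} (hx : ∀ a, x * φ a = φ (τ a) * x) (hxx : x * x = φ w) (a b c d : R) :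
    (φ a + φ b * x) * (φ c + φ d * x) =
      φ (a * c + b * τ d * w) + φ (a * d + b * τ c) * x := by
  have h₁ : φ b * x * φ c = φ b * φ (τ c) * x := by rw [mul_assoc, hx, mul_assoc]
  have h₂ : φ b * x * (φ d * x) = φ b * φ (τ d) * φ w := by
    rw [mul_assoc, ← mul_assoc x, hx, mul_assoc (φ (τ d)), hxx, mul_assoc]
  simp only [map_add, map_mul, add_mul, mul_add, h₁, h₂, mul_assoc]
  abel

/-- `A` is the free rank-two extension `R ⊕ R x` of the commutative ring `R`, twisted by the
endomorphism `τ` through `x a = τ(a) x` and with `x² = w ∈ R`. -/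
structure IsTwistedQuadratic {R A : Type*} [CommRing R] [Ring A] (φ : R →+* A) (τ : R →+* R)
    (w : R) (x : A) : Prop where
  x_mul (a : R) : x * φ a = φ (τ a) * x
  x_mul_x : x * x = φ w
  exists_eq (z : A) : ∃ a b, z = φ a + φ b * x
  eq_zero (a b : R) : φ a + φ b * x = 0 → a = 0 ∧ b = 0

namespace IsTwistedQuadratic

variable {R A : Type*} [CommRing R] [Ring A] {φ : R →+* A} {τ : R →+* R} {w : R} {x : A}

theorem eq_and_eq (hA : IsTwistedQuadratic φ τ w x) {a b c d : R}
    (h : φ a + φ b * x = φ c + φ d * x) : a = c ∧ b = d := by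
  have := hA.eq_zero (a - c) (b - d) (by
    rw [← sub_eq_zero] at h
    rw [← h, map_sub, map_sub]; noncomm_ring)
  exact ⟨sub_eq_zero.1 this.1, sub_eq_zero.1 this.2⟩

theorem mul_eq (hA : IsTwistedQuadratic φ τ w x) (a b c d : R) :
    (φ a + φ b * x) * (φ c + φ d * x) =
      φ (a * c + b * τ d * w) + φ (a * d + b * τ c) * x :=
  twisted_mul_eq hA.x_mul hA.x_mul_x a b c d

theorem commute_of_map_eq (hA : IsTwistedQuadratic φ τ w x) {z : R} (hz : τ z = z) (u : A) :
    φ z * u = u * φ z := by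
  obtain ⟨a, b, rfl⟩ := hA.exists_eq u
  have h := hA.mul_eq z 0 a b
  have h' := hA.mul_eq a b z 0
  simp only [map_zero, zero_mul, mul_zero, add_zero, hz, zero_add] at h h'
  rw [h, h', mul_comm z a, mul_comm z b]

theorem exists_map_eq_of_commute (hA : IsTwistedQuadratic φ τ w x) {h h' : R} (hτ : τ h = h')
    (hreg : ∀ a, (h - h') * a = 0 → a = 0) {u : A} (huh : u * φ h = φ h * u)
    (hux : u * x = x * u) : ∃ z, τ z = z ∧ u = φ z := by
  obtain ⟨a, b, rfl⟩ := hA.exists_eq u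
  have e₁ := hA.mul_eq a b h 0
  have e₂ := hA.mul_eq h 0 a b
  simp only [map_zero, zero_mul, mul_zero, add_zero, zero_add, hτ] at e₁ e₂
  rw [e₁, e₂] at huh
  have hb : b = 0 := hreg b (by linear_combination -(hA.eq_and_eq huh).2)
  subst hb
  simp only [map_zero, zero_mul, add_zero, hA.x_mul] at hux ⊢
  refine ⟨a, ?_, rfl⟩
  exact ((hA.eq_and_eq (a := 0) (c := 0) (by rw [map_zero, zero_add, zero_add, hux])).2).symm

theorem commutator_map (hA : IsTwistedQuadratic φ τ w x) (p q h : R) :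
    (φ p + φ q * x) * φ h - φ h * (φ p + φ q * x) = φ (q * (τ h - h)) * x := by
  have e₁ := hA.mul_eq p q h 0
  have e₂ := hA.mul_eq h 0 p q
  simp only [map_zero, zero_mul, mul_zero, add_zero, zero_add] at e₁ e₂
  rw [e₁, e₂, mul_comm h p, mul_comm h q, add_sub_add_left_eq_sub, ← sub_mul, ← map_sub, mul_sub]

theorem commutator_x (hA : IsTwistedQuadratic φ τ w x) (p q : R) :
    (φ p + φ q * x) * x - x * (φ p + φ q * x) = φ ((q - τ q) * w) + φ (p - τ p) * x := by
  have e₁ := hA.mul_eq p q 0 1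
  have e₂ := hA.mul_eq 0 1 p q
  simp only [map_zero, map_one, zero_mul, mul_zero, add_zero, zero_add, mul_one, one_mul]
    at e₁ e₂
  rw [e₁, e₂, sub_mul, map_sub, map_sub]
  noncomm_ring

/-- Each derivation agrees on `h` and `x` with an inner derivation plus
`h ↦ (h² - 1) z₁`, `x ↦ z₂ x`, where `z₁` and `z₂` are fixed by the twist. -/
theorem exists_decomposition (hA : IsTwistedQuadratic φ τ w x) (hw : IsUnit w)
    (hττ : ∀ a, τ (τ a) = a) {h h' e : R} (hh : h * h' = 1) (hτ : τ h = h') (he : 2 * e = 1)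
    (hreg : ∀ a, (h - h') * a = 0 → a = 0) (hdvd : ∀ a, h - h' ∣ τ a - a)
    {y : A} (hyx : y * x = 1) (D : A →+ A) (hD : ∀ u v, D (u * v) = D u * v + u * D v) :
    ∃ (t : A) (z₁ z₂ : R), τ z₁ = z₁ ∧ τ z₂ = z₂ ∧
      D (φ h) = t * φ h - φ h * t + (φ h * φ h - 1) * φ z₁ ∧
      D x = t * x - x * t + φ z₂ * x := by
  have hτ' : τ h' = h := by rw [← hτ, hττ]
  have hτe : τ e = e := by
    have : 2 * τ e = 1 := by rw [← map_ofNat τ 2, ← map_mul, he, map_one]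
    linear_combination (-τ e) * he + e * this
  obtain ⟨a, b, hDh⟩ := hA.exists_eq (D (φ h))
  obtain ⟨c, d, hDx⟩ := hA.exists_eq (D x * y)
  have hDx : D x = φ (d * w) + φ c * x := by
    rw [← mul_one (D x), ← hyx, ← mul_assoc, hDx, add_mul, mul_assoc, hA.x_mul_x, ← map_mul,
      add_comm]
  have hDh' : D (φ h') = φ (-(h' * h' * a)) + φ (-b) * x := by
    have h1 : D 1 = 0 := by simpa using hD 1 1
    rw [← map_one φ, ← hh, map_mul, hD, hDh] at h1
    have h2 : φ h' * φ h = 1 := by rw [← map_mul, mul_comm, hh, map_one]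
    have h3 : D (φ h') = -(φ h' * ((φ a + φ b * x) * φ h')) := by
      rw [eq_neg_of_add_eq_zero_left h1, mul_neg, neg_neg, ← mul_assoc, h2, one_mul]
    have e₁ := hA.mul_eq a b h' 0
    have e₂ := hA.mul_eq h' 0 (a * h') (b * h)
    simp only [map_zero, zero_mul, mul_zero, add_zero, zero_add, hτ'] at e₁ e₂
    rw [h3, e₁, e₂, neg_add, ← neg_mul, ← map_neg, ← map_neg]
    congr 3
    · ring_nf
    · congr 1
      linear_combination b * hh
  have key : D (x * φ h) = D (φ h' * x) := by rw [hA.x_mul, hτ]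
  rw [hD, hD, hDx, hDh, hDh'] at key
  have e₁ := hA.mul_eq (d * w) c h 0
  have e₂ := hA.mul_eq 0 1 a b
  have e₃ := hA.mul_eq (-(h' * h' * a)) (-b) 0 1
  have e₄ := hA.mul_eq h' 0 (d * w) c
  simp only [map_zero, map_one, zero_mul, mul_zero, add_zero, zero_add, mul_one, one_mul, hτ]
    at e₁ e₂ e₃ e₄
  have collect : ∀ p q r s : R, φ p + φ q * x + (φ r + φ s * x) = φ (p + r) + φ (q + s) * x := by
    intro p q r s
    rw [map_add, map_add]; noncomm_ring
  rw [e₁, e₂, e₃, e₄, collect, collect] at key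
  obtain ⟨k₁, k₂⟩ := hA.eq_and_eq key
  have hb : b + τ b = (h' - h) * d := hw.mul_right_cancel (by linear_combination k₁)
  have ha : τ a = -(h' * h' * a) := by linear_combination k₂
  obtain ⟨q, hq⟩ := hdvd b
  obtain ⟨r, hr⟩ := hdvd (h' * a)
  rw [map_mul, hτ', ha] at hr
  have hbβ : b = e * (d + q) * (h' - h) := by
    linear_combination (-b) * he + e * hb - e * hq
  generalize e * (d + q) = β at hbβ
  have hdβ : d = β - τ β := by
    have hτb := congrArg τ hbβ
    rw [map_mul, map_sub, hτ, hτ'] at hτb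
    rw [← sub_eq_zero]
    exact hreg _ (by linear_combination hb - hbβ - hτb)
  have hz : h' * a = (h - h') * (-(e * r)) := by
    linear_combination (-(h' * a)) * he - e * hr - e * h' * a * hh
  generalize -(e * r) = z at hz
  refine ⟨φ (e * c) + φ β * x, z, e * (c + τ c), ?_, ?_, ?_, ?_⟩
  · have hτz := congrArg τ hz
    rw [map_mul, map_mul, map_sub, hτ, hτ', ha] at hτz
    rw [← sub_eq_zero]
    exact hreg _ (by linear_combination hz + hτz + h' * a * hh)
  · rw [map_mul, map_add, hττ, hτe, add_comm]
  · rw [hA.commutator_map, hDh, hτ, ← hbβ, ← map_mul, ← map_one φ, ← map_sub, ← map_mul, add_comm]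
    congr 2
    linear_combination h * hz + (-z - a) * hh
  · rw [hA.commutator_x, hDx, hdβ, map_mul τ, hτe, add_assoc, ← add_mul, ← map_add]
    congr 3
    linear_combination (-c) * he

theorem eq_zero_of_commutator_add_eq_zero (hA : IsTwistedQuadratic φ τ w x)
    (hττ : ∀ a, τ (τ a) = a) {h h' e : R} (hh : h * h' = 1) (hτ : τ h = h') (he : 2 * e = 1)
    (hreg : ∀ a, (h - h') * a = 0 → a = 0) {t : A} {z₁ z₂ : R} (hz₂ : τ z₂ = z₂)
    (hth : t * φ h - φ h * t + (φ h * φ h - 1) * φ z₁ = 0)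
    (htx : t * x - x * t + φ z₂ * x = 0) : z₁ = 0 ∧ z₂ = 0 ∧ ∀ u, t * u = u * t := by
  obtain ⟨p, q, rfl⟩ := hA.exists_eq t
  rw [hA.commutator_map, ← map_mul, ← map_one φ, ← map_sub, ← map_mul, add_comm] at hth
  obtain ⟨h₁, h₂⟩ := hA.eq_zero _ _ hth
  rw [hA.commutator_x, add_assoc, ← add_mul, ← map_add] at htx
  obtain ⟨-, h₃⟩ := hA.eq_zero _ _ htx
  rw [hτ] at h₂
  have hq : q = 0 := hreg q (by linear_combination -h₂)
  have hz₁ : z₁ = 0 := hreg z₁ (by linear_combination h' * h₁ - h * z₁ * hh)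
  have h₄ := congrArg τ h₃
  rw [map_add, map_sub, hττ, hz₂, map_zero] at h₄
  have hz₂' : z₂ = 0 := by linear_combination (-z₂) * he + e * (h₃ + h₄)
  refine ⟨hz₁, hz₂', fun u => ?_⟩
  rw [hq, map_zero, zero_mul, add_zero]
  exact hA.commute_of_map_eq (by linear_combination hz₂' - h₃) u

end IsTwistedQuadratic

namespace LaurentPolynomial

theorem ringHom_ext_C_T {R S : Type*} [Semiring R] [Semiring S] {f g : R[T;T⁻¹] →+* S}
    (hC : ∀ a, f (C a) = g (C a)) (hT : f (T 1) = g (T 1)) : f = g := by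
  ext
  · exact hC _
  · exact hT

theorem algEquiv_C {k : Type*} [CommRing k] (σ : k[T;T⁻¹] ≃ₐ[k] k[T;T⁻¹]) (c : k) :
    σ (C c) = C c :=
  σ.commutes c

theorem algEquiv_involutive_of_map_T {k : Type*} [CommRing k] {σ : k[T;T⁻¹] ≃ₐ[k] k[T;T⁻¹]}
    (hσ : σ (T 1) = T (-1)) (p : k[T;T⁻¹]) : σ (σ p) = p := by
  have hσ' : σ (T (-1)) = T 1 := by
    have h : σ (T (-1)) * T (-1) = 1 := by
      rw [← map_one σ, ← T_zero, ← neg_add_cancel 1, T_add, map_mul, hσ]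
    calc σ (T (-1)) = σ (T (-1)) * T (-1) * T 1 := by
          rw [mul_assoc, ← T_add, neg_add_cancel, T_zero, mul_one]
      _ = T 1 := by rw [h, one_mul]
  have : ((σ : k[T;T⁻¹] →+* k[T;T⁻¹]).comp (σ : k[T;T⁻¹] →+* k[T;T⁻¹])) = RingHom.id _ := by
    refine ringHom_ext_C_T (fun a => ?_) ?_
    · simp [algEquiv_C]
    · simp [hσ, hσ']
  exact RingHom.congr_fun this p

end LaurentPolynomial

namespace GWA

section

variable {k : Type*} [CommRing k] (σ : LaurentPolynomial k ≃ₐ[k] LaurentPolynomial k)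
  (a : LaurentPolynomial k)

/-- The inclusion of `k[h^{±1}]` into the generalized Weyl algebra. -/
noncomputable def rHom : LaurentPolynomial k →+* GWA k σ a where
  toFun := r σ a
  map_one' := by
    have := RingQuot.mkAlgHom_rel k (GWARel.one (k := k) (σ := σ) (a := a))
    rwa [map_one] at this
  map_mul' p q := by
    have := RingQuot.mkAlgHom_rel k (GWARel.mul (k := k) (σ := σ) (a := a) p q)
    rwa [map_mul] at this
  map_zero' := by
    have := RingQuot.mkAlgHom_rel k (GWARel.smul (k := k) (σ := σ) (a := a) 0 0)
    rwa [zero_smul, zero_smul, map_zero] at this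
  map_add' p q := by
    have := RingQuot.mkAlgHom_rel k (GWARel.add (k := k) (σ := σ) (a := a) p q)
    rwa [map_add] at this

theorem rHom_apply (p : LaurentPolynomial k) : rHom σ a p = r σ a p :=
  rfl

theorem y_mul_x_one : y σ 1 * x σ 1 = 1 := by
  rw [y_mul_x]; exact map_one (rHom σ 1)

theorem x_mul_y_one : x σ 1 * y σ 1 = 1 := by
  rw [x_mul_y, map_one]; exact map_one (rHom σ 1)

/-- When `a = 1`, the generator `x` is a unit with inverse `y`. -/
noncomputable def xUnit : (GWA k σ 1)ˣ := ⟨x σ 1, y σ 1, x_mul_y_one σ, y_mul_x_one σ⟩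

/-- An element of a generalized Weyl algebra lies in a subring as soon as the subring contains
`k[h^{±1}]`, `x` and `y`. -/
theorem mem_subring (S : Subring (GWA k σ a)) (hr : ∀ p, r σ a p ∈ S) (hx : x σ a ∈ S)
    (hy : y σ a ∈ S) (z : GWA k σ a) : z ∈ S := by
  obtain ⟨f, rfl⟩ := RingQuot.mkAlgHom_surjective k (GWARel k σ a) z
  induction f using FreeAlgebra.induction with
  | grade0 c =>
    rw [AlgHom.commutes, Algebra.algebraMap_eq_smul_one, ← map_one (rHom σ a)]
    exact r_smul σ a c 1 ▸ hr _
  | grade1 i =>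
    rcases i with p | i
    · exact hr p
    · fin_cases i
      exacts [hx, hy]
  | mul f g hf hg => rw [map_mul]; exact S.mul_mem hf hg
  | add f g hf hg => rw [map_add]; exact S.add_mem hf hg

end

section Involution

variable {k : Type*} [CommRing k] {σ : LaurentPolynomial k ≃ₐ[k] LaurentPolynomial k}

theorem commute_r_xUnit_sq (hσ : ∀ p, σ (σ p) = p) (p : LaurentPolynomial k) :
    Commute (r σ 1 p) ((xUnit σ ^ 2 : (GWA k σ 1)ˣ) : GWA k σ 1) := by
  rw [Units.val_pow_eq_pow_val, pow_two]
  change r σ 1 p * (x σ 1 * x σ 1) = x σ 1 * x σ 1 * r σ 1 p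
  rw [mul_assoc (x σ 1), x_mul_r, ← mul_assoc (x σ 1), x_mul_r, hσ, mul_assoc]

/-- The map `k[h^{±1}][w^{±1}] → k[h^{±1}](σ, 1)` with `w ↦ x²`, for `σ` an involution. -/
noncomputable def evenHom (hσ : ∀ p, σ (σ p) = p) :
    LaurentPolynomial (LaurentPolynomial k) →+* GWA k σ 1 :=
  AddMonoidAlgebra.liftNCRingHom (rHom σ 1)
    ((Units.coeHom (GWA k σ 1)).comp (zpowersHom (GWA k σ 1)ˣ (xUnit σ ^ 2)))
    (fun p n => by
      rw [MonoidHom.comp_apply, zpowersHom_apply]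
      exact (commute_r_xUnit_sq hσ p).units_zpow_right n.toAdd)

theorem evenHom_C (hσ : ∀ p, σ (σ p) = p) (p : LaurentPolynomial k) :
    evenHom hσ (C p) = r σ 1 p := by
  refine (AddMonoidAlgebra.liftNCRingHom_single _ _ _ _ _).trans ?_
  simp [rHom_apply]

theorem evenHom_T (hσ : ∀ p, σ (σ p) = p) : evenHom hσ (T 1) = x σ 1 * x σ 1 := by
  refine (AddMonoidAlgebra.liftNCRingHom_single _ _ _ _ _).trans ?_
  simp [pow_two, xUnit]

/-- The automorphism `σ` applied to the coefficients of a Laurent polynomial over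
`k[h^{±1}]`. -/
noncomputable def twist (σ : LaurentPolynomial k ≃ₐ[k] LaurentPolynomial k) :
    LaurentPolynomial (LaurentPolynomial k) →+* LaurentPolynomial (LaurentPolynomial k) :=
  AddMonoidAlgebra.mapRingHom ℤ (σ : LaurentPolynomial k →+* LaurentPolynomial k)

@[simp]
theorem twist_C (p : LaurentPolynomial k) : twist σ (C p) = C (σ p) :=
  AddMonoidAlgebra.mapRingHom_single _ _ _

@[simp]
theorem twist_T (n : ℤ) : twist σ (T n) = T n := by
  refine (AddMonoidAlgebra.mapRingHom_single _ _ _).trans ?_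
  rw [map_one, T]

theorem twist_twist (hσ : ∀ p, σ (σ p) = p) (p : LaurentPolynomial (LaurentPolynomial k)) :
    twist σ (twist σ p) = p := by
  have : (twist σ).comp (twist σ) = RingHom.id _ :=
    ringHom_ext_C_T (fun a => by simp [hσ]) (by simp)
  exact RingHom.congr_fun this p

theorem x_mul_evenHom (hσ : ∀ p, σ (σ p) = p) (p : LaurentPolynomial (LaurentPolynomial k)) :
    x σ 1 * evenHom hσ p = evenHom hσ (twist σ p) * x σ 1 := by
  have : ((MulSemiringAction.toRingHom (ConjAct (GWA k σ 1)ˣ) (GWA k σ 1)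
      (ConjAct.toConjAct (xUnit σ))).comp (evenHom hσ)) = (evenHom hσ).comp (twist σ) := by
    refine ringHom_ext_C_T (fun a => ?_) ?_
    · change x σ 1 * evenHom hσ (C a) * y σ 1 = evenHom hσ (twist σ (C a))
      rw [twist_C, evenHom_C, evenHom_C, x_mul_r, mul_assoc, x_mul_y_one, mul_one]
    · change x σ 1 * evenHom hσ (T 1) * y σ 1 = evenHom hσ (twist σ (T 1))
      rw [twist_T, evenHom_T, mul_assoc, mul_assoc, x_mul_y_one, mul_one]
  have h : x σ 1 * evenHom hσ p * y σ 1 = evenHom hσ (twist σ p) := RingHom.congr_fun this p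
  rw [← h, mul_assoc _ (y σ 1), y_mul_x_one, mul_one]

theorem exists_eq_evenHom_add (hσ : ∀ p, σ (σ p) = p) (z : GWA k σ 1) :
    ∃ a b, z = evenHom hσ a + evenHom hσ b * x σ 1 := by
  let S : Subring (GWA k σ 1) :=
    { carrier := {z | ∃ a b, z = evenHom hσ a + evenHom hσ b * x σ 1}
      mul_mem' := by
        rintro _ _ ⟨a, b, rfl⟩ ⟨c, d, rfl⟩
        exact ⟨_, _, twisted_mul_eq (x_mul_evenHom hσ) (evenHom_T hσ).symm a b c d⟩
      one_mem' := ⟨1, 0, by simp⟩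
      add_mem' := by
        rintro _ _ ⟨a, b, rfl⟩ ⟨c, d, rfl⟩
        exact ⟨a + c, b + d, by rw [map_add, map_add]; noncomm_ring⟩
      zero_mem' := ⟨0, 0, by simp⟩
      neg_mem' := by
        rintro _ ⟨a, b, rfl⟩
        exact ⟨-a, -b, by rw [map_neg, map_neg, neg_add, neg_mul (evenHom hσ b)]⟩ }
  refine mem_subring σ 1 S (fun p => ⟨C p, 0, by simp [evenHom_C]⟩) ⟨0, 1, by simp⟩
    ⟨0, T (-1), ?_⟩ z
  have h : evenHom hσ (T (-1)) * (x σ 1 * x σ 1) = 1 := by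
    rw [← evenHom_T hσ, ← map_mul, ← T_add, neg_add_cancel, T_zero, map_one]
  calc y σ 1 = evenHom hσ (T (-1)) * (x σ 1 * x σ 1) * y σ 1 := by rw [h, one_mul]
    _ = _ := by rw [mul_assoc, mul_assoc, x_mul_y_one, mul_one, map_zero, zero_add]

/-- The ring homomorphism `p ↦ diag(p, τ p)`. -/
def diagTwist {R : Type*} [CommRing R] (τ : R →+* R) : R →+* Matrix (Fin 2) (Fin 2) R where
  toFun p := !![p, 0; 0, τ p]
  map_one' := by simp [Matrix.one_fin_two]
  map_mul' p q := by simp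
  map_zero' := by ext i j; fin_cases i <;> fin_cases j <;> simp
  map_add' p q := by simp

/-- The representation of `k[h^{±1}](σ, 1)`, for `σ` an involution, by two-by-two matrices over
`k[h^{±1}][w^{±1}]`, in which `x` has square `w`. -/
noncomputable def matrixRep (hσ : ∀ p, σ (σ p) = p) :
    GWA k σ 1 →ₐ[k] Matrix (Fin 2) (Fin 2) (LaurentPolynomial (LaurentPolynomial k)) :=
  RingQuot.liftAlgHom k ⟨FreeAlgebra.lift k (Sum.elim (fun p => diagTwist (twist σ) (C p))
    ![!![0, T 1; 1, 0], !![0, 1; T (-1), 0]]), by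
      have hsymm : ∀ p, σ.symm p = σ p := fun p => by rw [AlgEquiv.symm_apply_eq, hσ]
      have hT : (T 1 * T (-1) : LaurentPolynomial (LaurentPolynomial k)) = 1 := by
        rw [← T_add, add_neg_cancel, T_zero]
      have hT' : (T (-1) * T 1 : LaurentPolynomial (LaurentPolynomial k)) = 1 := by
        rw [← T_add, neg_add_cancel, T_zero]
      rintro _ _ (_ | _ | ⟨c, p⟩ | _ | p | p | _ | _)
      · simp
      · simp
      · have hC : ∀ q : LaurentPolynomial k, C (c • q) = c • C q := fun q =>
          (AddMonoidAlgebra.smul_single _ _ _).symm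
        simp [diagTwist, hC]
      · simp
      · simp [diagTwist, hσ, T_mul 1]
      · simp [diagTwist, hσ, hsymm, T_mul (-1)]
      · simp [diagTwist, hT']
      · simp [diagTwist, hT]⟩

theorem matrixRep_r (hσ : ∀ p, σ (σ p) = p) (p : LaurentPolynomial k) :
    matrixRep hσ (r σ 1 p) = diagTwist (twist σ) (C p) := by
  rw [matrixRep, r, RingQuot.liftAlgHom_mkAlgHom_apply, FreeAlgebra.lift_ι_apply, Sum.elim_inl]

theorem matrixRep_x (hσ : ∀ p, σ (σ p) = p) :
    matrixRep hσ (x σ 1) = !![0, T 1; 1, 0] := by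
  rw [matrixRep, x, RingQuot.liftAlgHom_mkAlgHom_apply, FreeAlgebra.lift_ι_apply, Sum.elim_inr,
    Matrix.cons_val_zero]

theorem matrixRep_evenHom (hσ : ∀ p, σ (σ p) = p) (p : LaurentPolynomial (LaurentPolynomial k)) :
    matrixRep hσ (evenHom hσ p) = diagTwist (twist σ) p := by
  have : (matrixRep hσ : GWA k σ 1 →+* _).comp (evenHom hσ) = diagTwist (twist σ) := by
    refine ringHom_ext_C_T (fun a => ?_) ?_
    · simp [evenHom_C, matrixRep_r]
    · simp [evenHom_T, matrixRep_x, diagTwist]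
  exact RingHom.congr_fun this p

theorem isTwistedQuadratic (hσ : ∀ p, σ (σ p) = p) :
    IsTwistedQuadratic (evenHom hσ) (twist σ) (T 1) (x σ 1) where
  x_mul := x_mul_evenHom hσ
  x_mul_x := (evenHom_T hσ).symm
  exists_eq := exists_eq_evenHom_add hσ
  eq_zero a b h := by
    have h' := congrArg (matrixRep hσ) h
    rw [map_add, map_mul, map_zero, matrixRep_evenHom, matrixRep_evenHom, matrixRep_x] at h'
    have h₀ := congrFun (congrFun h' 0) 0
    have h₁ := congrFun (congrFun h' 1) 0
    simp [diagTwist] at h₀ h₁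
    refine ⟨h₀, ?_⟩
    rw [← twist_twist hσ b, h₁, map_zero]

theorem sub_dvd_twist_sub (hσ : σ (T 1) = T (-1)) (p : LaurentPolynomial (LaurentPolynomial k)) :
    C (T 1) - C (T (-1)) ∣ twist σ p - p := by
  set I := Ideal.span {(C (T 1) - C (T (-1)) : LaurentPolynomial (LaurentPolynomial k))} with hI
  have hC : (Ideal.Quotient.mk I).comp
      (C.comp (σ : LaurentPolynomial k →+* LaurentPolynomial k)) =
      (Ideal.Quotient.mk I).comp C := by
    refine ringHom_ext_C_T (fun a => ?_) ?_
    · simp [algEquiv_C]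
    · refine Eq.symm (Ideal.Quotient.eq.2 ?_)
      simp [hI, hσ]
  have : (Ideal.Quotient.mk I).comp (twist σ) = Ideal.Quotient.mk I :=
    ringHom_ext_C_T (fun a => by simpa using RingHom.congr_fun hC a) (by simp)
  exact Ideal.mem_span_singleton.1 (Ideal.Quotient.eq.1 (RingHom.congr_fun this p))

end Involution

end GWA

theorem C_T_sub_C_T_ne_zero {k : Type*} [CommRing k] [Nontrivial k] :
    (C (T 1) - C (T (-1)) : LaurentPolynomial (LaurentPolynomial k)) ≠ 0 := by
  intro h
  have h₀ := congrArg (fun p => (p.coeff 0).coeff 1) (sub_eq_zero.1 h)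
  simp at h₀

section Derivation

variable {k A : Type*} [CommRing k] [Ring A] [Algebra k A]

theorem adDer_apply (t u : A) : adDer (k := k) t u = t * u - u * t :=
  rfl

theorem isDeriv_adDer (t : A) : IsDeriv (adDer (k := k) t) := fun u v => by
  simp only [adDer_apply]
  noncomm_ring

theorem IsDeriv.sub {D E : A →ₗ[k] A} (hD : IsDeriv D) (hE : IsDeriv E) : IsDeriv (D - E) :=
  fun u v => by
    simp only [LinearMap.sub_apply, hD u v, hE u v]
    noncomm_ring

theorem IsDeriv.map_inverse {D : A →ₗ[k] A} (hD : IsDeriv D) {x y z : A} (hxy : x * y = 1)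
    (hyx : y * x = 1) (hz : ∀ u, z * u = u * z) (hx : D x = z * x) : D y = -(z * y) := by
  have h1 : D 1 = 0 := by simpa using hD 1 1
  rw [← hyx, hD, hx] at h1
  have h2 : (D y * x + y * (z * x)) * y = D y + z * y := by
    rw [add_mul, mul_assoc, hxy, mul_one, mul_assoc, mul_assoc, hxy, mul_one, hz]
  rw [h1, zero_mul] at h2
  exact eq_neg_of_add_eq_zero_left h2.symm

end Derivation

/-- Over a field of characteristic not `2`, every derivation `D` of
`A = k[h^{±1}](σ_inv, 1)` (with `σ_inv(h) = h⁻¹`) can be written as `D = ad_t + D_{z₁,z₂}`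
with `t ∈ A` and `z₁, z₂ ∈ Z(A)`, where `D_{z₁,z₂}` is the derivation with
`D_{z₁,z₂}(h) = (h² − 1) z₁`, `D_{z₁,z₂}(x) = z₂ x`, `D_{z₁,z₂}(y) = −z₂ y`; moreover
`z₁`, `z₂` and the inner derivation `ad_t` are uniquely determined by `D`. -/
theorem derivations_involution_gwa_one (k : Type*) [Field k] (hchar : (2 : k) ≠ 0)
    (σ : LaurentPolynomial k ≃ₐ[k] LaurentPolynomial k) (hσ : σ (T 1) = T (-1))
    (D : GWA k σ 1 →ₗ[k] GWA k σ 1) (hD : IsDeriv D) :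
    (∃ (t z₁ z₂ : GWA k σ 1) (δ : GWA k σ 1 →ₗ[k] GWA k σ 1),
        z₁ ∈ Subalgebra.center k (GWA k σ 1) ∧ z₂ ∈ Subalgebra.center k (GWA k σ 1) ∧
          IsDeriv δ ∧ δ (GWA.H σ 1) = (GWA.H σ 1 * GWA.H σ 1 - 1) * z₁ ∧
          δ (GWA.x σ 1) = z₂ * GWA.x σ 1 ∧ δ (GWA.y σ 1) = -(z₂ * GWA.y σ 1) ∧
          D = adDer (k := k) t + δ) ∧
      ∀ (t t' z₁ z₁' z₂ z₂' : GWA k σ 1) (δ δ' : GWA k σ 1 →ₗ[k] GWA k σ 1),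
        z₁ ∈ Subalgebra.center k (GWA k σ 1) → z₂ ∈ Subalgebra.center k (GWA k σ 1) →
          IsDeriv δ → δ (GWA.H σ 1) = (GWA.H σ 1 * GWA.H σ 1 - 1) * z₁ →
          δ (GWA.x σ 1) = z₂ * GWA.x σ 1 → δ (GWA.y σ 1) = -(z₂ * GWA.y σ 1) →
          D = adDer (k := k) t + δ →
        z₁' ∈ Subalgebra.center k (GWA k σ 1) → z₂' ∈ Subalgebra.center k (GWA k σ 1) →
          IsDeriv δ' → δ' (GWA.H σ 1) = (GWA.H σ 1 * GWA.H σ 1 - 1) * z₁' →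
          δ' (GWA.x σ 1) = z₂' * GWA.x σ 1 → δ' (GWA.y σ 1) = -(z₂' * GWA.y σ 1) →
          D = adDer (k := k) t' + δ' →
        z₁ = z₁' ∧ z₂ = z₂' ∧ adDer (k := k) t = adDer (k := k) t' := by
  have hσσ := algEquiv_involutive_of_map_T hσ
  have hA := GWA.isTwistedQuadratic hσσ
  have hττ := GWA.twist_twist hσσ
  have hh : (C (T 1) * C (T (-1)) : LaurentPolynomial (LaurentPolynomial k)) = 1 := by
    rw [← map_mul, ← T_add, add_neg_cancel, T_zero, map_one]
  have hτ : GWA.twist σ (C (T 1)) = C (T (-1)) := by rw [GWA.twist_C, hσ]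
  have he : 2 * algebraMap k (LaurentPolynomial (LaurentPolynomial k)) 2⁻¹ = 1 := by
    rw [← map_ofNat (algebraMap k _) 2, ← map_mul, mul_inv_cancel₀ hchar, map_one]
  have hreg : ∀ a : LaurentPolynomial (LaurentPolynomial k),
      (C (T 1) - C (T (-1))) * a = 0 → a = 0 := fun a ha =>
    (mul_eq_zero.1 ha).resolve_left C_T_sub_C_T_ne_zero
  have hH : GWA.H σ 1 = GWA.evenHom hσσ (C (T 1)) := (GWA.evenHom_C hσσ _).symm
  have hcenter : ∀ u, u ∈ Subalgebra.center k (GWA k σ 1) →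
      ∃ z, GWA.twist σ z = z ∧ u = GWA.evenHom hσσ z := fun u hu =>
    hA.exists_map_eq_of_commute hτ hreg (Subalgebra.mem_center_iff.1 hu _).symm
      (Subalgebra.mem_center_iff.1 hu _).symm
  constructor
  · obtain ⟨t, z₁, z₂, hz₁, hz₂, hDh, hDx⟩ := hA.exists_decomposition (isUnit_T 1) hττ hh hτ he
      hreg (GWA.sub_dvd_twist_sub hσ) (GWA.y_mul_x_one σ) D.toAddMonoidHom hD
    have hδ := hD.sub (isDeriv_adDer (k := k) t)
    have hδx : (D - adDer (k := k) t) (GWA.x σ 1) = GWA.evenHom hσσ z₂ * GWA.x σ 1 := by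
      rw [LinearMap.sub_apply, adDer_apply, sub_eq_iff_eq_add']
      exact hDx
    refine ⟨t, GWA.evenHom hσσ z₁, GWA.evenHom hσσ z₂, D - adDer (k := k) t,
      Subalgebra.mem_center_iff.2 fun u => (hA.commute_of_map_eq hz₁ u).symm,
      Subalgebra.mem_center_iff.2 fun u => (hA.commute_of_map_eq hz₂ u).symm,
      hδ, ?_, hδx, ?_, by abel⟩
    · rw [LinearMap.sub_apply, adDer_apply, sub_eq_iff_eq_add', hH]
      exact hDh
    · exact hδ.map_inverse (GWA.x_mul_y_one σ) (GWA.y_mul_x_one σ) (hA.commute_of_map_eq hz₂) hδx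
  · intro t t' z₁ z₁' z₂ z₂' δ δ' hz₁ hz₂ _ hδh hδx _ hDt hz₁' hz₂' _ hδh' hδx' _ hDt'
    have hzero : ∀ u, (t - t') * u - u * (t - t') + (δ u - δ' u) = 0 := fun u => by
      have := LinearMap.congr_fun (hDt.symm.trans hDt') u
      simp only [LinearMap.add_apply, adDer_apply] at this
      rw [← sub_eq_zero] at this
      rw [← this, sub_mul, mul_sub]
      abel
    obtain ⟨ζ₁, -, hζ₁⟩ := hcenter _ (sub_mem hz₁ hz₁')
    obtain ⟨ζ₂, hτζ₂, hζ₂⟩ := hcenter _ (sub_mem hz₂ hz₂')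
    have hth := hzero (GWA.H σ 1)
    have htx := hzero (GWA.x σ 1)
    rw [hδh, hδh', ← mul_sub, hζ₁, hH] at hth
    rw [hδx, hδx', ← sub_mul, hζ₂] at htx
    obtain ⟨rfl, rfl, hcomm⟩ :=
      hA.eq_zero_of_commutator_add_eq_zero hττ hh hτ he hreg hτζ₂ hth htx
    rw [map_zero, sub_eq_zero] at hζ₁ hζ₂
    refine ⟨hζ₁, hζ₂, LinearMap.ext fun u => ?_⟩
    have := hcomm u
    rw [sub_mul, mul_sub] at this
    rw [adDer_apply, adDer_apply, sub_eq_sub_iff_sub_eq_sub, this]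
end
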